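/- arXiv:2603.17157 — 2 statements merged into one kernel-verified Lean document; each statement's English description precedes it below -/
import Mathlib

section
/- Let R be an n×n real diagonal matrix with diagonal entries rᵢ ≥ r_min > 0, G an n×n real matrix, b ∈ ℝⁿ, b ≠ 0, and let 𝒥(x) = ½ xᵀRx + xᵀGx − bᵀx. If x^NE satisfies (R+G)x^NE = b, then |𝒥(x^NE)| ≥ (r_min/2) · ‖b‖² / (‖R‖ + ‖G‖)². -/
open scoped RealInnerProductSpace

/-- The action of a square matrix on Euclidean space `ℝⁿ`. -/
noncomputable def mApp {n : ℕ} (M : Matrix (Fin n) (Fin n) ℝ)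
    (x : EuclideanSpace ℝ (Fin n)) : EuclideanSpace ℝ (Fin n) :=
  Matrix.toEuclideanCLM (𝕜 := ℝ) M x

/-- The operator norm of a square matrix induced by the Euclidean norm. -/
noncomputable def opN {n : ℕ} (M : Matrix (Fin n) (Fin n) ℝ) : ℝ :=
  ‖Matrix.toEuclideanCLM (𝕜 := ℝ) M‖

/-- The aggregate cost `𝒥(x) = ½ xᵀRx + xᵀGx − bᵀx` of the LQ network game. -/
noncomputable def aggCost {n : ℕ} (R G : Matrix (Fin n) (Fin n) ℝ)
    (b x : EuclideanSpace ℝ (Fin n)) : ℝ :=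
  (1 / 2) * ⟪x, mApp R x⟫ + ⟪x, mApp G x⟫ - ⟪b, x⟫

theorem mApp_add {n : ℕ} (M N : Matrix (Fin n) (Fin n) ℝ) (x : EuclideanSpace ℝ (Fin n)) :
    mApp (M + N) x = mApp M x + mApp N x := by
  simp [mApp]

theorem norm_mApp_le {n : ℕ} (M : Matrix (Fin n) (Fin n) ℝ) (x : EuclideanSpace ℝ (Fin n)) :
    ‖mApp M x‖ ≤ opN M * ‖x‖ :=
  ContinuousLinearMap.le_opNorm _ x

theorem mul_norm_sq_le_inner_mApp_diagonal {n : ℕ} {r : Fin n → ℝ} {m : ℝ}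
    (hr : ∀ i, m ≤ r i) (x : EuclideanSpace ℝ (Fin n)) :
    m * ‖x‖ ^ 2 ≤ ⟪x, mApp (Matrix.diagonal r) x⟫ := by
  have h (i : Fin n) : mApp (Matrix.diagonal r) x i = r i * x i := by
    simp [mApp, Matrix.mulVec_diagonal]
  rw [EuclideanSpace.real_norm_sq_eq, Finset.mul_sum, PiLp.inner_apply]
  refine Finset.sum_le_sum fun i _ => ?_
  rw [h, ← smul_eq_mul (r i), real_inner_smul_right, real_inner_self_eq_norm_sq,
    Real.norm_eq_abs, sq_abs]
  exact mul_le_mul_of_nonneg_right (hr i) (sq_nonneg (x i))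

/-- At a solution of `(R + G) x = b` the aggregate cost reduces to `-½ xᵀRx`. -/
theorem aggCost_of_mApp_add_eq {n : ℕ} {R G : Matrix (Fin n) (Fin n) ℝ}
    {b x : EuclideanSpace ℝ (Fin n)} (hx : mApp (R + G) x = b) :
    aggCost R G b x = -((1 / 2) * ⟪x, mApp R x⟫) := by
  rw [aggCost, ← hx, mApp_add, real_inner_comm x, inner_add_right]
  ring

/-- With `R = diag(r)`, `rᵢ ≥ r_min > 0`, and `b ≠ 0`, if `(R+G)x^NE = b` then
`|𝒥(x^NE)| ≥ (r_min/2) ‖b‖²/(‖R‖ + ‖G‖)²`. -/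
theorem nash_cost_lower_bound (n : ℕ) (r : Fin n → ℝ) (rmin : ℝ)
    (hrmin : 0 < rmin) (hr : ∀ i, rmin ≤ r i)
    (G : Matrix (Fin n) (Fin n) ℝ) (b xNE : EuclideanSpace ℝ (Fin n)) (hb : b ≠ 0)
    (hx : mApp (Matrix.diagonal r + G) xNE = b) :
    rmin / 2 * ‖b‖ ^ 2 / (opN (Matrix.diagonal r) + opN G) ^ 2 ≤
      |aggCost (Matrix.diagonal r) G b xNE| := by
  have hb_le : ‖b‖ ≤ (opN (Matrix.diagonal r) + opN G) * ‖xNE‖ := by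
    rw [← hx, mApp_add, add_mul]
    exact norm_add_le_of_le (norm_mApp_le _ _) (norm_mApp_le _ _)
  have hinner := mul_norm_sq_le_inner_mApp_diagonal hr xNE
  rw [aggCost_of_mApp_add_eq hx, abs_neg]
  refine div_le_of_le_mul₀ (sq_nonneg _) (abs_nonneg _) ?_
  calc rmin / 2 * ‖b‖ ^ 2
      ≤ rmin / 2 * ((opN (Matrix.diagonal r) + opN G) * ‖xNE‖) ^ 2 := by gcongr
    _ = (1 / 2) * (rmin * ‖xNE‖ ^ 2) * (opN (Matrix.diagonal r) + opN G) ^ 2 := by ring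
    _ ≤ (1 / 2) * ⟪xNE, mApp (Matrix.diagonal r) xNE⟫ *
          (opN (Matrix.diagonal r) + opN G) ^ 2 := by gcongr
    _ ≤ _ := by gcongr; exact le_abs_self _
end

section
/- (Bounds on the Value of Misspecification.) Let r_min > 0 and 0 ≤ g < r_min. There exists a constant C > 0, depending only on r_min and g, such that for every n×n real diagonal matrix R with diagonal entries rᵢ ≥ r_min, every pair of n×n real matrices G, G̃ with ‖G‖ ≤ g and ‖G̃‖ ≤ g, and every b ∈ ℝⁿ with b ≠ 0, the Value of Misspecification VoM := (𝒥(x^BN) − 𝒥(x^NE)) / 𝒥(x^NE) satisfies |VoM| ≤ C · (‖R‖ + ‖G‖)² / r_min² · ‖G̃ − G‖, where x^NE solves (R+G)x = b, x^BN solves (R+G̃)x = b, and 𝒥(x) = ½ xᵀRx + xᵀGx − bᵀx. -/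
open scoped RealInnerProductSpace

section Quadratic

variable {E : Type*} [NormedAddCommGroup E] [InnerProductSpace ℝ E]

theorem abs_inner_apply_le (A : E →L[ℝ] E) (x y : E) : |⟪x, A y⟫| ≤ ‖A‖ * ‖x‖ * ‖y‖ := by
  calc |⟪x, A y⟫| ≤ ‖x‖ * ‖A y‖ := abs_real_inner_le_norm _ _
    _ ≤ ‖x‖ * (‖A‖ * ‖y‖) := by gcongr; exact A.le_opNorm y
    _ = ‖A‖ * ‖x‖ * ‖y‖ := by ring

/-- If `A` is coercive with constant `ρ` and `‖B‖ ≤ g`, then `A + B` is bounded below by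
`ρ - g`. -/
theorem sub_mul_norm_le_norm_add_apply {A B : E →L[ℝ] E} {ρ g : ℝ}
    (hA : ∀ x, ρ * ‖x‖ ^ 2 ≤ ⟪x, A x⟫) (hB : ‖B‖ ≤ g) (x : E) :
    (ρ - g) * ‖x‖ ≤ ‖A x + B x‖ := by
  rcases (norm_nonneg x).eq_or_lt with hx | hx
  · simp [← hx]
  have h₁ := real_inner_le_norm x (A x + B x)
  rw [inner_add_right] at h₁
  have h₂ := (abs_le.1 (abs_inner_apply_le B x x)).1
  have h₃ : ‖B‖ * ‖x‖ * ‖x‖ ≤ g * ‖x‖ * ‖x‖ := by gcongr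
  refine le_of_mul_le_mul_left ?_ hx
  nlinarith [hA x]

/-- The relative change of a symmetric coercive quadratic cost when its equilibrium `x` is
replaced by the equilibrium `y` of the perturbed equation. -/
theorem abs_relative_cost_le {A B B' : E →L[ℝ] E} {ρ g : ℝ} (hρ : 0 < ρ) (hg : g < ρ)
    (hAs : A.toLinearMap.IsSymmetric) (hA : ∀ x, ρ * ‖x‖ ^ 2 ≤ ⟪x, A x⟫)
    (hB : ‖B‖ ≤ g) (hB' : ‖B'‖ ≤ g)
    {b x y : E} (hb : b ≠ 0) (hx : A x + B x = b) (hy : A y + B' y = b)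
    {J : E → ℝ} (hJ : ∀ z, J z = (1 / 2) * ⟪z, A z⟫ + ⟪z, B z⟫ - ⟪b, z⟫) :
    |(J y - J x) / J x| ≤
      2 * (2 * g / (ρ - g) ^ 2 + 1 / (ρ - g)) * (‖A‖ + ‖B‖) ^ 2 / ρ ^ 2 * ‖B' - B‖ := by
  have hk : 0 < ρ - g := sub_pos.2 hg
  have hg0 : 0 ≤ g := (norm_nonneg B).trans hB
  have hx0 : 0 < ‖x‖ := by
    refine norm_pos_iff.2 fun h => hb ?_
    rw [← hx, h]; simp
  obtain ⟨d, rfl⟩ : ∃ d, y = x + d := ⟨y - x, by simp⟩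
  have hd : ‖d‖ ≤ ‖B' - B‖ * ‖x‖ / (ρ - g) := by
    have h₁ := sub_mul_norm_le_norm_add_apply hA hB' d
    have h₂ : A d + B' d = -((B' - B) x) := by
      rw [← hx, map_add, map_add] at hy
      simp only [sub_apply, neg_sub]
      rw [← sub_eq_zero] at hy ⊢
      rw [← hy]
      abel
    rw [h₂, norm_neg] at h₁
    rw [le_div_iff₀' hk]
    exact h₁.trans ((B' - B).le_opNorm x)
  have hΔ : ‖B' - B‖ ≤ 2 * g := (norm_sub_le _ _).trans (by linarith)
  have hρA : ρ ≤ ‖A‖ := by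
    have h := (hA x).trans ((le_abs_self _).trans (abs_inner_apply_le A x x))
    refine le_of_mul_le_mul_right (a := ‖x‖ ^ 2) ?_ (by positivity)
    linarith
  have hJx : J x = -((1 / 2) * ⟪x, A x⟫) := by
    rw [hJ, ← hx, inner_add_left, real_inner_comm x (A x), real_inner_comm x (B x)]
    ring
  have hdiff : J (x + d) - J x = (1 / 2) * ⟪d, A d⟫ + ⟪d, B d⟫ + ⟪x, B d⟫ := by
    have hs : ⟪x, A d⟫ = ⟪d, A x⟫ := (hAs x d).symm.trans (real_inner_comm _ _)
    rw [hJ, hJ, ← hx]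
    simp only [map_add, inner_add_left, inner_add_right, real_inner_comm d (A x),
      real_inner_comm d (B x), hs]
    ring
  set S := ‖A‖ + ‖B‖ with hS
  set K := 2 * g / (ρ - g) ^ 2 + 1 / (ρ - g) with hK
  have hK0 : 0 ≤ K := by positivity
  have hρS : ρ ≤ S := by linarith [norm_nonneg B]
  have hS0 : 0 < S := hρ.trans_le hρS
  have hnum : |J (x + d) - J x| ≤ S * K * ‖B' - B‖ * ‖x‖ ^ 2 := by
    have hd2 : ‖d‖ ≤ 2 * g * ‖x‖ / (ρ - g) := hd.trans (by gcongr)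
    have h₁ : |J (x + d) - J x| ≤ S * (‖d‖ * ‖d‖ + ‖x‖ * ‖d‖) := by
      have hAd := abs_le.1 (abs_inner_apply_le A d d)
      have hBd := abs_le.1 (abs_inner_apply_le B d d)
      have hBx := abs_le.1 (abs_inner_apply_le B x d)
      have h₂ : 0 ≤ ‖A‖ * ‖d‖ * ‖d‖ := by positivity
      have h₃ : 0 ≤ ‖A‖ * ‖x‖ * ‖d‖ := by positivity
      rw [hdiff, hS, abs_le]
      constructor <;> linarith
    calc |J (x + d) - J x| ≤ S * (‖d‖ * ‖d‖ + ‖x‖ * ‖d‖) := h₁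
      _ ≤ S * (2 * g * ‖x‖ / (ρ - g) * (‖B' - B‖ * ‖x‖ / (ρ - g))
          + ‖x‖ * (‖B' - B‖ * ‖x‖ / (ρ - g))) := by gcongr
      _ = S * K * ‖B' - B‖ * ‖x‖ ^ 2 := by rw [hK]; field_simp
  have hden : ρ / 2 * ‖x‖ ^ 2 ≤ |J x| := by
    rw [hJx, abs_neg]
    exact le_trans (by linarith [hA x]) (le_abs_self _)
  calc |(J (x + d) - J x) / J x| = |J (x + d) - J x| / |J x| := abs_div _ _
    _ ≤ S * K * ‖B' - B‖ * ‖x‖ ^ 2 / (ρ / 2 * ‖x‖ ^ 2) := by gcongr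
    _ = 2 * K * ‖B' - B‖ * (S / ρ) := by field_simp
    _ ≤ 2 * K * ‖B' - B‖ * (S / ρ) ^ 2 := by
      gcongr
      exact le_self_pow₀ ((one_le_div hρ).2 hρS) two_ne_zero
    _ = 2 * K * S ^ 2 / ρ ^ 2 * ‖B' - B‖ := by ring

end Quadratic

theorem isSymmetric_toEuclideanCLM_diagonal {n : ℕ} (r : Fin n → ℝ) :
    (Matrix.toEuclideanCLM (𝕜 := ℝ) (Matrix.diagonal r)).toLinearMap.IsSymmetric := by
  intro x y
  simp only [ContinuousLinearMap.coe_coe, PiLp.inner_apply, Matrix.ofLp_toEuclideanCLM,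
    Matrix.mulVec_diagonal, RCLike.inner_apply, conj_trivial]
  exact Finset.sum_congr rfl fun i _ => by ring

theorem mul_norm_sq_le_inner_diagonal {n : ℕ} {r : Fin n → ℝ} {ρ : ℝ} (hr : ∀ i, ρ ≤ r i)
    (x : EuclideanSpace ℝ (Fin n)) :
    ρ * ‖x‖ ^ 2 ≤ ⟪x, Matrix.toEuclideanCLM (𝕜 := ℝ) (Matrix.diagonal r) x⟫ := by
  rw [EuclideanSpace.real_norm_sq_eq, Finset.mul_sum, PiLp.inner_apply]
  refine Finset.sum_le_sum fun i _ => ?_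
  simp only [Matrix.ofLp_toEuclideanCLM, Matrix.mulVec_diagonal, RCLike.inner_apply, conj_trivial]
  nlinarith [mul_le_mul_of_nonneg_right (hr i) (sq_nonneg (x i))]

/-- Bounds on the Value of Misspecification: For `0 < r_min` and
`0 ≤ g < r_min` there is `C > 0` (depending only on `r_min` and `g`) such that for every
diagonal `R` with entries `rᵢ ≥ r_min`, all `G, G̃` with `‖G‖ ≤ g`, `‖G̃‖ ≤ g`, and every
`b ≠ 0`, the Value of Misspecification `VoM = (𝒥(x^BN) − 𝒥(x^NE))/𝒥(x^NE)` satisfies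
`|VoM| ≤ C (‖R‖ + ‖G‖)²/r_min² · ‖G̃ − G‖`, where `(R+G)x^NE = b` and `(R+G̃)x^BN = b`. -/
theorem vom_bound (rmin g : ℝ) (hrmin : 0 < rmin) (hg0 : 0 ≤ g) (hg : g < rmin) :
    ∃ C > (0 : ℝ), ∀ (n : ℕ) (r : Fin n → ℝ) (G Gt : Matrix (Fin n) (Fin n) ℝ)
      (b xNE xBN : EuclideanSpace ℝ (Fin n)),
      (∀ i, rmin ≤ r i) → opN G ≤ g → opN Gt ≤ g → b ≠ 0 →
      mApp (Matrix.diagonal r + G) xNE = b → mApp (Matrix.diagonal r + Gt) xBN = b →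
      |(aggCost (Matrix.diagonal r) G b xBN - aggCost (Matrix.diagonal r) G b xNE) /
          aggCost (Matrix.diagonal r) G b xNE| ≤
        C * (opN (Matrix.diagonal r) + opN G) ^ 2 / rmin ^ 2 * opN (Gt - G) := by
  have hk : 0 < rmin - g := sub_pos.2 hg
  refine ⟨2 * (2 * g / (rmin - g) ^ 2 + 1 / (rmin - g)), by positivity, ?_⟩
  intro n r G Gt b xNE xBN hr hG hGt hb hNE hBN
  unfold opN at *
  unfold mApp at hNE hBN
  rw [map_add, add_apply] at hNE hBN
  rw [map_sub]
  exact abs_relative_cost_le hrmin hg (isSymmetric_toEuclideanCLM_diagonal r)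
    (mul_norm_sq_le_inner_diagonal hr) hG hGt hb hNE hBN fun _ => rfl
end
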